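/- Let μ > 0, ε > 0 with μ/ε ≥ 1, let M ≥ 1 and r ∈ {1,…,M}, and let B_{μ,r} be the set of M×M real matrices Q with rank(Q) ≤ r and Frobenius norm ‖Q‖_F ≤ μ. Then the covering number of B_{μ,r} with respect to the Frobenius norm satisfies N(ε, B_{μ,r}) ≤ (9μ/ε)^{(2M+1)r+1} ≤ (9μ/ε)^{4Mr}. -/

import Mathlib

/-- The Frobenius norm `‖Q‖_F = √tr(QQᵀ)`. -/
noncomputable def frobNorm {M : ℕ} (Q : Matrix (Fin M) (Fin M) ℝ) : ℝ :=
  Real.sqrt (Matrix.trace (Q * Q.transpose))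

/-- `B_{μ,r}`: the set of `M × M` real matrices with rank at most `r` and
Frobenius norm at most `μ`. -/
def frobRankBall (M : ℕ) (μ : ℝ) (r : ℕ) : Set (Matrix (Fin M) (Fin M) ℝ) :=
  {Q | Q.rank ≤ r ∧ frobNorm Q ≤ μ}

open MeasureTheory Metric Module in
/-- The volumetric bound on the size of a separated subset of a ball. -/
theorem card_le_of_separated_of_norm_le {E : Type*} [NormedAddCommGroup E] [NormedSpace ℝ E]
    [FiniteDimensional ℝ E] {R δ : ℝ} (hR : 0 ≤ R) (hδ : 0 < δ) (s : Finset E)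
    (hs : ∀ c ∈ s, ‖c‖ ≤ R) (h : ∀ c ∈ s, ∀ d ∈ s, c ≠ d → δ ≤ ‖c - d‖) :
    (s.card : ℝ) ≤ (1 + 2 * R / δ) ^ finrank ℝ E := by
  borelize E
  let μ : Measure E := Measure.addHaar
  have hδ2 : 0 < δ / 2 := by positivity
  have hρ : 0 < R + δ / 2 := by positivity
  have hdisj : Set.Pairwise (s : Set E) (Function.onFun Disjoint fun c => ball (c : E) (δ / 2)) := by
    rintro c hc d hd hcd
    apply ball_disjoint_ball
    rw [dist_eq_norm]
    linarith [h c hc d hd hcd]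
  have hsub : (⋃ c ∈ s, ball (c : E) (δ / 2)) ⊆ ball (0 : E) (R + δ / 2) := by
    refine Set.iUnion₂_subset fun x hx => ball_subset_ball' ?_
    rw [dist_zero_right]
    linarith [hs x hx]
  have hvol : (s.card : ENNReal) * ENNReal.ofReal ((δ / 2) ^ finrank ℝ E) * μ (ball 0 1) ≤
      ENNReal.ofReal ((R + δ / 2) ^ finrank ℝ E) * μ (ball 0 1) := by
    calc
      _ = μ (⋃ c ∈ s, ball (c : E) (δ / 2)) := by
        rw [measure_biUnion_finset hdisj fun c _ => measurableSet_ball]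
        simp only [μ.addHaar_ball_of_pos _ hδ2, Finset.sum_const, nsmul_eq_mul, mul_assoc]
      _ ≤ μ (ball (0 : E) (R + δ / 2)) := measure_mono hsub
      _ = _ := μ.addHaar_ball_of_pos _ hρ
  have hcard := ENNReal.toReal_le_of_le_ofReal (pow_nonneg hρ.le _)
    ((ENNReal.mul_le_mul_iff_left (measure_ball_pos _ _ zero_lt_one).ne' measure_ball_lt_top.ne).1
      hvol)
  rw [ENNReal.toReal_mul, ENNReal.toReal_natCast, ENNReal.toReal_ofReal (by positivity),
    ← le_div_iff₀ (by positivity), ← div_pow] at hcard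
  have hbase : 1 + 2 * R / δ = (R + δ / 2) / (δ / 2) := by
    field_simp
    ring
  rwa [hbase]

/-- A ball of radius `R` in a finite-dimensional normed space has an internal `δ`-net of
cardinality at most `(1 + 2R/δ)^dim`. -/
theorem exists_finset_cover_closedBall {E : Type*} [NormedAddCommGroup E] [NormedSpace ℝ E]
    [FiniteDimensional ℝ E] {R δ : ℝ} (hR : 0 ≤ R) (hδ : 0 < δ) :
    ∃ s : Finset E, (s.card : ℝ) ≤ (1 + 2 * R / δ) ^ Module.finrank ℝ E ∧
      (∀ c ∈ s, ‖c‖ ≤ R) ∧ ∀ x : E, ‖x‖ ≤ R → ∃ c ∈ s, ‖x - c‖ ≤ δ := by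
  classical
  let P : Finset E → Prop := fun s =>
    (∀ c ∈ s, ‖c‖ ≤ R) ∧ ∀ c ∈ s, ∀ d ∈ s, c ≠ d → δ ≤ ‖c - d‖
  have hbound : ∀ s, P s → (s.card : ℝ) ≤ (1 + 2 * R / δ) ^ Module.finrank ℝ E :=
    fun s hs => card_le_of_separated_of_norm_le hR hδ s hs.1 hs.2
  let K : Set ℕ := {n | ∃ s, P s ∧ s.card = n}
  have hbdd : BddAbove K := by
    refine ⟨⌊(1 + 2 * R / δ) ^ Module.finrank ℝ E⌋₊, ?_⟩
    rintro _ ⟨s, hs, rfl⟩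
    exact Nat.le_floor (hbound s hs)
  obtain ⟨s, hs, hcard⟩ := Nat.sSup_mem (s := K) ⟨0, ∅, by simp [P], rfl⟩ hbdd
  refine ⟨s, hbound s hs, hs.1, fun x hx => ?_⟩
  by_contra! hfar
  have hxs : x ∉ s := fun hmem => by
    have := hfar x hmem
    rw [sub_self, norm_zero] at this
    linarith
  have hins : P (insert x s) := by
    refine ⟨fun c hc => ?_, fun c hc d hd hcd => ?_⟩
    · rcases Finset.mem_insert.1 hc with rfl | hc
      exacts [hx, hs.1 c hc]
    · rcases Finset.mem_insert.1 hc with rfl | hcs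
      · exact (hfar d ((Finset.mem_insert.1 hd).resolve_left hcd.symm)).le
      · rcases Finset.mem_insert.1 hd with rfl | hds
        · rw [norm_sub_rev]
          exact (hfar c hcs).le
        · exact hs.2 c hcs d hds hcd
  have hle : (insert x s).card ≤ sSup K := le_csSup hbdd ⟨_, hins, rfl⟩
  rw [Finset.card_insert_of_notMem hxs] at hle
  omega

/-- A subspace of dimension at most `r` embeds isometrically into `ℝʳ`. -/
theorem exists_linearIsometry_euclideanSpace {E : Type*} [NormedAddCommGroup E]
    [InnerProductSpace ℝ E] [FiniteDimensional ℝ E] {r : ℕ} (h : Module.finrank ℝ E ≤ r) :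
    Nonempty (E →ₗᵢ[ℝ] EuclideanSpace ℝ (Fin r)) := by
  let b := stdOrthonormalBasis ℝ E
  let v : Fin (Module.finrank ℝ E) → EuclideanSpace ℝ (Fin r) :=
    fun i => EuclideanSpace.basisFun (Fin r) ℝ (Fin.castLE h i)
  have hv : Orthonormal ℝ v :=
    (EuclideanSpace.basisFun (Fin r) ℝ).orthonormal.comp _ (Fin.castLE_injective h)
  refine ⟨(b.toBasis.constr ℝ v).isometryOfOrthonormal (v := b.toBasis) ?_ ?_⟩
  · simp
  · convert hv
    ext1 i
    simp

/-- Any family of vectors spanning a space of dimension at most `r` factors through `ℝʳ` via a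
contraction, without increasing norms. -/
theorem exists_contraction_factorization {E ι : Type*} [NormedAddCommGroup E]
    [InnerProductSpace ℝ E] [FiniteDimensional ℝ E] {r : ℕ} (W : Submodule ℝ E)
    (hW : Module.finrank ℝ W ≤ r) (q : ι → E) (hq : ∀ j, q j ∈ W) :
    ∃ (A : EuclideanSpace ℝ (Fin r) →L[ℝ] E) (v : ι → EuclideanSpace ℝ (Fin r)),
      ‖A‖ ≤ 1 ∧ ∀ j, A (v j) = q j ∧ ‖v j‖ = ‖q j‖ := by
  have := FiniteDimensional.complete ℝ W
  obtain ⟨L⟩ := exists_linearIsometry_euclideanSpace hW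
  refine ⟨W.subtypeL ∘L ContinuousLinearMap.adjoint L.toContinuousLinearMap,
    fun j => L ⟨q j, hq j⟩, ?_, fun j => ⟨?_, ?_⟩⟩
  · refine (ContinuousLinearMap.opNorm_comp_le _ _).trans ?_
    rw [LinearIsometryEquiv.norm_map]
    exact mul_le_one₀ W.subtypeₗᵢ.norm_toContinuousLinearMap_le (norm_nonneg _)
      L.norm_toContinuousLinearMap_le
  · have hL : ContinuousLinearMap.adjoint L.toContinuousLinearMap (L ⟨q j, hq j⟩) = ⟨q j, hq j⟩ := by
      refine ext_inner_right ℝ fun w => ?_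
      rw [ContinuousLinearMap.adjoint_inner_left]
      exact L.inner_map_map _ _
    simp [hL]
  · rw [L.norm_map]
    rfl

/-- The matrix with columns `q j`. -/
def matrixOfCols {M : ℕ} (q : PiLp 2 fun _ : Fin M => EuclideanSpace ℝ (Fin M)) :
    Matrix (Fin M) (Fin M) ℝ :=
  Matrix.of fun i j => q j i

theorem frobNorm_matrixOfCols {M : ℕ} (q : PiLp 2 fun _ : Fin M => EuclideanSpace ℝ (Fin M)) :
    frobNorm (matrixOfCols q) = ‖q‖ := by
  rw [PiLp.norm_eq_of_L2, frobNorm]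
  congr 1
  simp only [EuclideanSpace.norm_sq_eq, Matrix.trace, Matrix.diag, Matrix.mul_apply,
    Matrix.transpose_apply, matrixOfCols, Matrix.of_apply, Real.norm_eq_abs, sq_abs, ← sq]
  exact Finset.sum_comm

/-- Apply a linear map to every vector of a finite family. -/
noncomputable def mapCols {E F : Type*} [NormedAddCommGroup E] [NormedSpace ℝ E]
    [NormedAddCommGroup F] [NormedSpace ℝ F] {M : ℕ} (A : E →L[ℝ] F)
    (v : PiLp 2 fun _ : Fin M => E) : PiLp 2 fun _ : Fin M => F :=
  WithLp.toLp 2 fun j => A (v j)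

theorem norm_mapCols_le {E F : Type*} [NormedAddCommGroup E] [NormedSpace ℝ E]
    [NormedAddCommGroup F] [NormedSpace ℝ F] {M : ℕ} (A : E →L[ℝ] F)
    (v : PiLp 2 fun _ : Fin M => E) : ‖mapCols A v‖ ≤ ‖A‖ * ‖v‖ := by
  refine le_of_sq_le_sq ?_ (by positivity)
  rw [mul_pow, PiLp.norm_sq_eq_of_L2, PiLp.norm_sq_eq_of_L2, Finset.mul_sum]
  refine Finset.sum_le_sum fun j _ => ?_
  rw [← mul_pow]
  exact pow_le_pow_left₀ (norm_nonneg _) (A.le_opNorm _) 2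

/-- Every matrix in `B_{μ,r}` is a product of a contraction and a family of vectors
of total norm at most `μ`. -/
theorem exists_factorization_of_mem_frobRankBall {M r : ℕ} {μ : ℝ}
    {Q : Matrix (Fin M) (Fin M) ℝ} (hQ : Q ∈ frobRankBall M μ r) :
    ∃ (A : EuclideanSpace ℝ (Fin r) →L[ℝ] EuclideanSpace ℝ (Fin M))
      (v : PiLp 2 fun _ : Fin M => EuclideanSpace ℝ (Fin r)),
      ‖A‖ ≤ 1 ∧ ‖v‖ ≤ μ ∧ Q = matrixOfCols (mapCols A v) := by
  obtain ⟨hrank, hnorm⟩ := hQ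
  let b := (EuclideanSpace.basisFun (Fin M) ℝ).toBasis
  rw [Matrix.rank_eq_finrank_range_toLin Q b b] at hrank
  let q : PiLp 2 fun _ : Fin M => EuclideanSpace ℝ (Fin M) :=
    WithLp.toLp 2 fun j => WithLp.toLp 2 fun i => Q i j
  have hq : ∀ j, q j ∈ LinearMap.range (Matrix.toLin b b Q) := fun j => by
    refine ⟨b j, ?_⟩
    rw [Matrix.toLin_self]
    ext i
    simp [b, q, Pi.single_apply]
  obtain ⟨A, v, hA, hv⟩ := exists_contraction_factorization _ hrank q.ofLp hq
  have hQq : Q = matrixOfCols q := rfl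
  refine ⟨A, WithLp.toLp 2 v, hA, ?_, ?_⟩
  · rw [hQq, frobNorm_matrixOfCols] at hnorm
    refine le_trans (le_of_eq ?_) hnorm
    rw [PiLp.norm_eq_of_L2, PiLp.norm_eq_of_L2]
    simp only [(hv _).2]
  · ext i j
    simp [matrixOfCols, mapCols, (hv j).1, q]

/-- Covering-number bound for the rank-`r` Frobenius ball:
`N(ε, B_{μ,r}) ≤ (9μ/ε)^{(2M+1)r+1} ≤ (9μ/ε)^{4Mr}` whenever `μ/ε ≥ 1`. -/
theorem statement11 (M : ℕ) (hM : 1 ≤ M) (r : ℕ) (hr1 : 1 ≤ r) (hrM : r ≤ M)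
    (μ ε : ℝ) (hμ : 0 < μ) (hε : 0 < ε) (hμε : μ / ε ≥ 1) :
    (∃ S : Finset (Matrix (Fin M) (Fin M) ℝ),
      (S.card : ℝ) ≤ (9 * μ / ε) ^ ((2 * M + 1) * r + 1) ∧
      ∀ Q ∈ frobRankBall M μ r, ∃ B ∈ S, frobNorm (Q - B) ≤ ε) ∧
    (9 * μ / ε : ℝ) ^ ((2 * M + 1) * r + 1) ≤ (9 * μ / ε : ℝ) ^ (4 * M * r) := by
  classical
  have h9 : 9 * μ / ε = 9 * (μ / ε) := by ring
  have h1 : 1 ≤ 9 * μ / ε := by rw [h9]; linarith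
  refine ⟨?_, pow_le_pow_right₀ h1 (by nlinarith)⟩
  obtain ⟨T, hTcard, hTnorm, hTcov⟩ := exists_finset_cover_closedBall
    (E := EuclideanSpace ℝ (Fin r) →L[ℝ] EuclideanSpace ℝ (Fin M)) (R := 1)
    (δ := ε / (2 * μ)) zero_le_one (by positivity)
  obtain ⟨V, hVcard, hVnorm, hVcov⟩ := exists_finset_cover_closedBall
    (E := PiLp 2 fun _ : Fin M => EuclideanSpace ℝ (Fin r)) (R := μ)
    (δ := ε / 2) hμ.le (by positivity)
  have hTdim : Module.finrank ℝ (EuclideanSpace ℝ (Fin r) →L[ℝ] EuclideanSpace ℝ (Fin M)) =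
      r * M := by
    rw [← (LinearMap.toContinuousLinearMap (𝕜 := ℝ) (E := EuclideanSpace ℝ (Fin r))
      (F' := EuclideanSpace ℝ (Fin M))).finrank_eq, Module.finrank_linearMap]
    simp
  have hVdim : Module.finrank ℝ (PiLp 2 fun _ : Fin M => EuclideanSpace ℝ (Fin r)) = M * r := by
    rw [(WithLp.linearEquiv 2 ℝ (Fin M → EuclideanSpace ℝ (Fin r))).finrank_eq,
      Module.finrank_pi_fintype]
    simp
  have hbase : 1 + 2 * 1 / (ε / (2 * μ)) ≤ 9 * μ / ε := by
    have : 2 * 1 / (ε / (2 * μ)) = 4 * (μ / ε) := by field_simp; norm_num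
    rw [this, h9]
    linarith
  have hbase' : 1 + 2 * μ / (ε / 2) ≤ 9 * μ / ε := by
    have : 2 * μ / (ε / 2) = 4 * (μ / ε) := by field_simp; norm_num
    rw [this, h9]
    linarith
  rw [hTdim] at hTcard
  rw [hVdim] at hVcard
  refine ⟨(T ×ˢ V).image fun p => matrixOfCols (mapCols p.1 p.2), ?_, fun Q hQ => ?_⟩
  · calc (((T ×ˢ V).image fun p => matrixOfCols (mapCols p.1 p.2)).card : ℝ)
        ≤ ((T ×ˢ V).card : ℝ) := by exact_mod_cast Finset.card_image_le
      _ = (T.card : ℝ) * V.card := by rw [Finset.card_product]; push_cast; rfl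
      _ ≤ (9 * μ / ε) ^ (r * M) * (9 * μ / ε) ^ (M * r) := by
        gcongr
        · exact hTcard.trans (by gcongr)
        · exact hVcard.trans (by gcongr)
      _ = (9 * μ / ε) ^ (r * M + M * r) := (pow_add _ _ _).symm
      _ ≤ _ := pow_le_pow_right₀ h1 (by nlinarith)
  · obtain ⟨A, v, hA, hv, rfl⟩ := exists_factorization_of_mem_frobRankBall hQ
    obtain ⟨A', hA', hAA'⟩ := hTcov A hA
    obtain ⟨v', hv', hvv'⟩ := hVcov v hv
    refine ⟨_, Finset.mem_image_of_mem _ (Finset.mk_mem_product hA' hv'), ?_⟩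
    have hsplit : matrixOfCols (mapCols A v) - matrixOfCols (mapCols A' v') =
        matrixOfCols (mapCols (A - A') v + mapCols A' (v - v')) := by
      ext i j
      simp [matrixOfCols, mapCols]
    rw [hsplit, frobNorm_matrixOfCols]
    calc ‖mapCols (A - A') v + mapCols A' (v - v')‖
        ≤ ‖A - A'‖ * ‖v‖ + ‖A'‖ * ‖v - v'‖ :=
          (norm_add_le _ _).trans (add_le_add (norm_mapCols_le _ _) (norm_mapCols_le _ _))
      _ ≤ ε / (2 * μ) * μ + 1 * (ε / 2) := by
        gcongr
        exact hTnorm A' hA'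
      _ = ε := by field_simp; norm_num
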